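/- Let A be a nonzero simple C*-algebra and let α : G → Aut(A) be an action of a finite group G on A with the tracial Rokhlin property. Then the fixed point algebra A^α = {a ∈ A : α_g(a) = a for all g ∈ G} contains a nonzero projection. -/

import Mathlib

open Filter Topology

/-- Cuntz subequivalence `a ≾ b` in a C*-algebra. -/
def CuntzSubeq {A : Type*} [NonUnitalCStarAlgebra A] (a b : A) : Prop :=
  ∃ v : ℕ → A, Tendsto (fun n => ‖a - v n * b * star (v n)‖) atTop (nhds 0)

/-- A projection in a C*-algebra: a self-adjoint idempotent. -/
def IsProjection {A : Type*} [NonUnitalCStarAlgebra A] (p : A) : Prop :=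
  IsSelfAdjoint p ∧ p * p = p

/-- A C*-algebra is simple if it is nonzero and its only closed two-sided ideals
are `⊥` and `⊤`. -/
def IsSimpleCStarAlgebra (A : Type*) [NonUnitalCStarAlgebra A] : Prop :=
  (∃ a : A, a ≠ 0) ∧ ∀ I : TwoSidedIdeal A, IsClosed (I : Set A) → I = ⊥ ∨ I = ⊤

/-- `(c - ε)₊`, via the (non-unital) continuous functional calculus. -/
noncomputable def cutPos {A : Type*} [NonUnitalCStarAlgebra A] (c : A) (ε : ℝ) : A :=
  cfcₙ (fun t : ℝ => max (t - ε) 0) c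

/-- The tracial Rokhlin property for an action of a finite group `G` on a C*-algebra `A`. -/
def TracialRokhlinProperty {A : Type*} [NonUnitalCStarAlgebra A] [PartialOrder A]
    [StarOrderedRing A] {G : Type*} [Group G] [Fintype G]
    (α : G → A ≃⋆ₐ[ℂ] A) : Prop :=
  ∀ (F : Finset A) (ε : ℝ), 0 < ε → ∀ x y : A, 0 ≤ x → 0 ≤ y → ‖x‖ = 1 →
    ∃ p : G → A,
      (∀ g, IsProjection (p g)) ∧
      (∀ g h, g ≠ h → p g * p h = 0) ∧
      (∀ a ∈ F, ∀ g, ‖p g * a - a * p g‖ < ε) ∧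
      (∀ g h, ‖α g (p h) - p (g * h)‖ < ε) ∧
      CuntzSubeq (cutPos (y * y - y * (∑ g, p g) * y) ε) x ∧
      ‖(∑ g, p g) * x * (∑ g, p g)‖ > 1 - ε

section

variable {A : Type*} [NonUnitalCStarAlgebra A]

theorem IsProjection.norm_eq_one {p : A} (hp : IsProjection p) (h0 : p ≠ 0) : ‖p‖ = 1 := by
  have h := CStarRing.norm_star_mul_self (x := p)
  rw [hp.1.star_eq, hp.2] at h
  have := norm_pos_iff.mpr h0
  nlinarith

theorem IsProjection.norm_le_one {p : A} (hp : IsProjection p) : ‖p‖ ≤ 1 := by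
  rcases eq_or_ne p 0 with rfl | h0
  · simp
  · exact (hp.norm_eq_one h0).le

theorem IsProjection.sum {ι : Type*} [Fintype ι] {p : ι → A} (hp : ∀ i, IsProjection (p i))
    (horth : ∀ i j, i ≠ j → p i * p j = 0) : IsProjection (∑ i, p i) := by
  classical
  refine ⟨isSelfAdjoint_sum _ fun i _ => (hp i).1, ?_⟩
  rw [Finset.sum_mul_sum]
  refine Finset.sum_congr rfl fun i _ => ?_
  rw [Finset.sum_eq_single i (fun j _ hji => horth i j hji.symm) (by simp), (hp i).2]

theorem IsProjection.norm_mul_self_sub_le {p q : A} (hp : IsProjection p) {δ : ℝ} (hδ : δ ≤ 1)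
    (hpq : ‖q - p‖ ≤ δ) : ‖q * q - q‖ ≤ 4 * δ := by
  have hp1 := hp.norm_le_one
  have hq : ‖q‖ ≤ 2 := by
    calc ‖q‖ = ‖(q - p) + p‖ := by rw [sub_add_cancel]
      _ ≤ ‖q - p‖ + ‖p‖ := norm_add_le _ _
      _ ≤ 2 := by linarith
  have hδ0 : 0 ≤ δ := (norm_nonneg _).trans hpq
  have key : q * q - q = q * (q - p) + (q - p) * p - (q - p) := by
    rw [mul_sub, sub_mul, hp.2]; abel
  calc ‖q * q - q‖ ≤ ‖q‖ * ‖q - p‖ + ‖q - p‖ * ‖p‖ + ‖q - p‖ := by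
        rw [key]
        refine (norm_sub_le _ _).trans (add_le_add_left ((norm_add_le _ _).trans ?_) _)
        exact add_le_add (norm_mul_le _ _) (norm_mul_le _ _)
    _ ≤ 2 * δ + δ * 1 + δ := by gcongr
    _ = 4 * δ := by ring

/-- A continuous cut-off function that is `0` on `(-∞, 1/4]` and `1` on `[3/4, ∞)`. -/
noncomputable def spectralStep (t : ℝ) : ℝ := max 0 (min 1 (2 * t - 1 / 2))

theorem continuous_spectralStep : Continuous spectralStep := by
  unfold spectralStep; fun_prop

theorem spectralStep_of_le {t : ℝ} (ht : t ≤ 1 / 4) : spectralStep t = 0 :=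
  max_eq_left ((min_le_right _ _).trans (by linarith))

theorem spectralStep_of_ge {t : ℝ} (ht : 3 / 4 ≤ t) : spectralStep t = 1 := by
  rw [spectralStep, min_eq_left (by linarith)]
  norm_num

theorem spectralStep_zero : spectralStep 0 = 0 := spectralStep_of_le (by norm_num)

theorem abs_mul_self_sub_le_of_mem_quasispectrum {q : A} (hq : IsSelfAdjoint q) {t : ℝ}
    (ht : t ∈ quasispectrum ℝ q) : |t * t - t| ≤ ‖q * q - q‖ := by
  have h : cfcₙ (fun s : ℝ => s * s - s) q = q * q - q := by
    rw [cfcₙ_sub (fun s : ℝ => s * s) (fun s : ℝ => s) q,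
      cfcₙ_mul (fun s : ℝ => s) (fun s : ℝ => s) q, cfcₙ_id' ℝ q]
  rw [← h]
  exact norm_apply_le_norm_cfcₙ (fun s : ℝ => s * s - s) q ht

theorem le_or_ge_of_mem_quasispectrum {q : A} (hq : IsSelfAdjoint q)
    (hqq : ‖q * q - q‖ ≤ 1 / 8) {t : ℝ} (ht : t ∈ quasispectrum ℝ q) :
    |t| ≤ 1 / 4 ∨ 3 / 4 ≤ t := by
  have h := abs_le.mp ((abs_mul_self_sub_le_of_mem_quasispectrum hq ht).trans hqq)
  rcases le_or_gt (3 / 4) t with h1 | h1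
  · exact Or.inr h1
  · refine Or.inl (abs_le.mpr ⟨?_, ?_⟩) <;> by_contra! h2 <;> nlinarith

theorem isProjection_cfcₙ_spectralStep {q : A} (hq : IsSelfAdjoint q)
    (hqq : ‖q * q - q‖ ≤ 1 / 8) : IsProjection (cfcₙ spectralStep q) := by
  refine ⟨cfcₙ_predicate _ _, ?_⟩
  have hc := continuous_spectralStep.continuousOn (s := quasispectrum ℝ q)
  rw [← cfcₙ_mul spectralStep spectralStep q hc spectralStep_zero hc spectralStep_zero]
  refine cfcₙ_congr fun t ht => ?_
  rcases le_or_ge_of_mem_quasispectrum hq hqq ht with h | h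
  · simp [spectralStep_of_le (abs_le.mp h).2]
  · simp [spectralStep_of_ge h]

theorem cfcₙ_spectralStep_ne_zero {q : A} (hq : IsSelfAdjoint q)
    (hqq : ‖q * q - q‖ ≤ 1 / 8) (hnorm : 1 / 4 < ‖q‖) : cfcₙ spectralStep q ≠ 0 := by
  intro h0
  refine hnorm.not_ge ?_
  rw [← cfcₙ_id' ℝ q]
  refine norm_cfcₙ_le fun t ht => ?_
  rcases le_or_ge_of_mem_quasispectrum hq hqq ht with h | h
  · exact h
  · have := norm_apply_le_norm_cfcₙ spectralStep q ht
      (continuous_spectralStep.continuousOn) spectralStep_zero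
    rw [h0, spectralStep_of_ge h] at this
    norm_num at this

theorem exists_nonneg_norm_eq_one [PartialOrder A] [StarOrderedRing A] {a : A} (ha : a ≠ 0) :
    ∃ x : A, 0 ≤ x ∧ ‖x‖ = 1 := by
  have ha' := norm_ne_zero_iff.mpr ha
  refine ⟨star ((‖a‖⁻¹ : ℂ) • a) * ((‖a‖⁻¹ : ℂ) • a), star_mul_self_nonneg _, ?_⟩
  rw [CStarRing.norm_star_mul_self, norm_smul]
  simp [ha']

section Action

variable {G : Type*} [Fintype G] (α : G → A ≃⋆ₐ[ℂ] A)

/-- The average of the orbit of `a` under a family of automorphisms. -/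
noncomputable def orbitAverage (a : A) : A := (Fintype.card G : ℂ)⁻¹ • ∑ g, α g a

theorem isSelfAdjoint_orbitAverage {a : A} (ha : IsSelfAdjoint a) :
    IsSelfAdjoint (orbitAverage α a) := by
  exact IsSelfAdjoint.smul (by simp [IsSelfAdjoint])
    (isSelfAdjoint_sum _ fun g _ => ha.map (α g))

theorem norm_orbitAverage_sub_le [Nonempty G] {a : A} {δ : ℝ} (h : ∀ g, ‖α g a - a‖ ≤ δ) :
    ‖orbitAverage α a - a‖ ≤ δ := by
  have hn : (Fintype.card G : ℂ) ≠ 0 := by simp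
  have hn' : (Fintype.card G : ℝ) ≠ 0 := by simp
  have key : orbitAverage α a - a = (Fintype.card G : ℂ)⁻¹ • ∑ g, (α g a - a) := by
    rw [Finset.sum_sub_distrib, smul_sub, Finset.sum_const, Finset.card_univ,
      ← Nat.cast_smul_eq_nsmul ℂ, smul_smul, inv_mul_cancel₀ hn, one_smul, orbitAverage]
  have hsum : ‖∑ g, (α g a - a)‖ ≤ Fintype.card G * δ := by
    simpa using norm_sum_le_of_le Finset.univ fun g _ => h g
  calc ‖orbitAverage α a - a‖ = (Fintype.card G : ℝ)⁻¹ * ‖∑ g, (α g a - a)‖ := by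
        rw [key, norm_smul]; simp
    _ ≤ (Fintype.card G : ℝ)⁻¹ * (Fintype.card G * δ) := by gcongr
    _ = δ := inv_mul_cancel_left₀ hn' δ

variable [Group G]

theorem map_orbitAverage (hα : ∀ g h : G, ∀ a : A, α (g * h) a = α g (α h a)) (g : G) (a : A) :
    α g (orbitAverage α a) = orbitAverage α a := by
  simp only [orbitAverage, map_smul, map_sum, ← hα]
  congr 1
  exact Equiv.sum_comp (Equiv.mulLeft g) fun h => α h a

theorem norm_map_sum_sub_sum_le {p : G → A} {ε : ℝ}
    (h : ∀ g h, ‖α g (p h) - p (g * h)‖ ≤ ε) (g : G) :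
    ‖α g (∑ h, p h) - ∑ h, p h‖ ≤ Fintype.card G * ε := by
  have hre : ∑ h, p (g * h) = ∑ h, p h := Equiv.sum_comp (Equiv.mulLeft g) p
  conv_lhs => rw [map_sum, ← hre, ← Finset.sum_sub_distrib]
  simpa using norm_sum_le_of_le Finset.univ fun k _ => h g k

end Action

/-- A nonzero projection that is moved little by a finite group action can be perturbed to a
nonzero invariant projection. -/
theorem exists_nonzero_invariant_projection {G : Type*} [Group G] [Fintype G]
    (α : G → A ≃⋆ₐ[ℂ] A) (hα : ∀ g h : G, ∀ a : A, α (g * h) a = α g (α h a))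
    {p : A} (hp : IsProjection p) (hp0 : p ≠ 0) (hinv : ∀ g, ‖α g p - p‖ ≤ 1 / 32) :
    ∃ e : A, e ≠ 0 ∧ IsProjection e ∧ ∀ g : G, α g e = e := by
  set q := orbitAverage α p
  have hq : IsSelfAdjoint q := isSelfAdjoint_orbitAverage α hp.1
  have hqp : ‖q - p‖ ≤ 1 / 32 := norm_orbitAverage_sub_le α hinv
  have hqq : ‖q * q - q‖ ≤ 1 / 8 :=
    (hp.norm_mul_self_sub_le (by norm_num) hqp).trans (by norm_num)
  have hqn : 1 / 4 < ‖q‖ := by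
    have := norm_sub_norm_le p q
    rw [norm_sub_rev, hp.norm_eq_one hp0] at this
    linarith
  refine ⟨cfcₙ spectralStep q, cfcₙ_spectralStep_ne_zero hq hqq hqn,
    isProjection_cfcₙ_spectralStep hq hqq, fun g => ?_⟩
  have hαq : α g q = q := map_orbitAverage α hα g p
  have hcont : Continuous (α g) := (StarAlgEquiv.isometry (α g)).continuous
  have := NonUnitalStarAlgHomClass.map_cfcₙ (R := ℝ) (S := ℂ) (α g) spectralStep q
    continuous_spectralStep.continuousOn spectralStep_zero hcont hq (by rwa [hαq])
  rw [this, hαq]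

end

/-- If `A` is a nonzero simple C*-algebra and `α` is an action of a finite group `G` on `A` with
the tracial Rokhlin property, then the fixed point algebra `A^α` contains a nonzero
projection. -/
theorem exists_nonzero_projection_fixedPoint
    {A : Type*} [NonUnitalCStarAlgebra A] [PartialOrder A] [StarOrderedRing A]
    {G : Type*} [Group G] [Fintype G]
    (hA : IsSimpleCStarAlgebra A)
    (α : G → A ≃⋆ₐ[ℂ] A) (hα : ∀ g h : G, ∀ a : A, α (g * h) a = α g (α h a))
    (hTRP : TracialRokhlinProperty α) :
    ∃ p : A, p ≠ 0 ∧ IsProjection p ∧ ∀ g : G, α g p = p := by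
  obtain ⟨a, ha⟩ := hA.1
  obtain ⟨x, hx0, hx1⟩ := exists_nonneg_norm_eq_one ha
  have hn : (1 : ℝ) ≤ Fintype.card G := by exact_mod_cast Fintype.card_pos
  have hε : (0 : ℝ) < 1 / (32 * Fintype.card G) := by positivity
  have hε1 : (1 : ℝ) / (32 * Fintype.card G) ≤ 1 := by
    rw [div_le_one (by positivity)]; linarith
  obtain ⟨p, hp, horth, -, hαp, -, hnorm⟩ := hTRP ∅ _ hε x x hx0 hx0 hx1
  refine exists_nonzero_invariant_projection α hα (IsProjection.sum hp horth) ?_ fun g => ?_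
  · intro h0
    simp only [h0, zero_mul, norm_zero] at hnorm
    linarith
  · refine (norm_map_sum_sub_sum_le α (fun g h => (hαp g h).le) g).trans_eq ?_
    field_simp
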